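/- Assume λ > cT(1+T) and that F and F_T are twice continuously Fréchet differentiable (so that ||D²F(X)||, ||D²F_T(X)|| ≤ c as operators on H). Then for every (X,t) the optimal trajectory map X ↦ Y_{Xt}(s) is Fréchet differentiable, its derivative D_X Y(s) ∈ L(H;H) is the unique solution of the linear equation D_X Y(s) = I − ((s−t)/λ) D²F_T(Y(T)) D_X Y(T) − (1/λ) ∫_t^T D²F(Y(σ)) D_X Y(σ) (min(s,σ)−t) dσ, and sup_{t≤s≤T} ||D_X Y(s)||_{L(H;H)} ≤ λ/(λ − cT(T+1)). -/

import Mathlib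

open MeasureTheory Set
open scoped RealInnerProductSpace

variable {H : Type*} [NormedAddCommGroup H] [InnerProductSpace ℝ H] [CompleteSpace H]

/-- The state `X(s) = X + ∫_t^s v(σ) dσ` associated to the control `v`. -/
noncomputable def state (X : H) (t : ℝ) (v : ℝ → H) (s : ℝ) : H :=
  X + ∫ σ in t..s, v σ

/-- A control belongs to `L²(t,T;H)`. -/
def Admissible (t T : ℝ) (v : ℝ → H) : Prop :=
  IntervalIntegrable v volume t T ∧ IntervalIntegrable (fun s => ‖v s‖ ^ 2) volume t T

/-- The cost functional `J_{X,t}(v)`. -/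
noncomputable def cost (F FT : H → ℝ) (lam : ℝ) (X : H) (t T : ℝ) (v : ℝ → H) : ℝ :=
  lam / 2 * (∫ s in t..T, ‖v s‖ ^ 2) + (∫ s in t..T, F (state X t v s)) + FT (state X t v T)

/-- The value function `V(X,t) = inf_v J_{X,t}(v)`. -/
noncomputable def valueFn (F FT : H → ℝ) (lam T : ℝ) (X : H) (t : ℝ) : ℝ :=
  sInf ((fun v => cost F FT lam X t T v) '' {v : ℝ → H | Admissible t T v})

/-- The adjoint state `Z(s) = D F_T(Y(T)) + ∫_s^T D F(Y(σ)) dσ` associated to a path `Y`. -/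
noncomputable def adjZ (DF DFT : H → H) (T : ℝ) (Y : ℝ → H) (s : ℝ) : H :=
  DFT (Y T) + ∫ σ in s..T, DF (Y σ)

/-- `Y` solves the two-point boundary value problem
`dY/ds = -(1/λ) Z(s)`, `-dZ/ds = D F(Y(s))`, `Y(t) = X`, `Z(T) = D F_T(Y(T))`,
where `Z = adjZ DF DFT T Y` encodes the two last conditions. -/
def IsOptimalPath (DF DFT : H → H) (lam T : ℝ) (X : H) (t : ℝ) (Y : ℝ → H) : Prop :=
  ContinuousOn Y (Icc t T) ∧ Y t = X ∧
    ∀ s ∈ Icc t T, HasDerivWithinAt Y (-(1 / lam) • adjZ DF DFT T Y s) (Icc t T) s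

/-- A continuous function on a compact interval whose norm satisfies an affine self-improving
bound with slope `k < 1` is bounded by the fixed point of that bound. -/
theorem norm_le_div_one_sub_of_self_bound {E : Type*}
    [NormedAddCommGroup E] {t T k b : ℝ} (hk : k < 1)
    {u : ℝ → E} (hu : ContinuousOn u (Icc t T))
    (h : ∀ m, (∀ σ ∈ Icc t T, ‖u σ‖ ≤ m) → ∀ s ∈ Icc t T, ‖u s‖ ≤ k * m + b) :
    ∀ s ∈ Icc t T, ‖u s‖ ≤ b / (1 - k) := by
  intro s hs
  obtain ⟨x, hx, hmax⟩ := isCompact_Icc.exists_isMaxOn ⟨s, hs⟩ hu.norm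
  have h1 := h ‖u x‖ (fun σ hσ => hmax hσ) x hx
  refine (hmax hs).trans ?_
  rw [le_div_iff₀ (by linarith)]
  linarith

section Kernel

variable {E G : Type*} [NormedAddCommGroup E] [NormedSpace ℝ E]
  [NormedAddCommGroup G] [NormedSpace ℝ G]

/-- The operator `(a, g) ↦ ((s - t)/λ) a + (1/λ) ∫_t^T (min(s,σ) - t) g(σ) dσ`, the solution of
`-λ y'' = g`, `y(t) = 0`, `λ y'(T) = a`. -/
noncomputable def greenOp (lam t T s : ℝ) (a : E) (g : ℝ → E) : E :=
  ((s - t) / lam) • a + (1 / lam) • ∫ σ in t..T, (min s σ - t) • g σ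

theorem intervalIntegrable_min_sub_smul {t T : ℝ} (htT : t ≤ T) (s : ℝ) {g : ℝ → E}
    (hg : ContinuousOn g (Icc t T)) :
    IntervalIntegrable (fun σ => (min s σ - t) • g σ) volume t T := by
  apply ContinuousOn.intervalIntegrable
  rw [uIcc_of_le htT]
  exact (Continuous.continuousOn (by fun_prop)).smul hg

theorem greenOp_sub {lam t T s : ℝ} (htT : t ≤ T) (a a' : E) {g g' : ℝ → E}
    (hg : ContinuousOn g (Icc t T)) (hg' : ContinuousOn g' (Icc t T)) :
    greenOp lam t T s (a - a') (fun σ => g σ - g' σ)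
      = greenOp lam t T s a g - greenOp lam t T s a' g' := by
  simp only [greenOp, smul_sub]
  rw [intervalIntegral.integral_sub (intervalIntegrable_min_sub_smul htT s hg)
    (intervalIntegrable_min_sub_smul htT s hg')]
  simp only [smul_sub]
  abel

theorem norm_greenOp_le {lam t T s m : ℝ} (hlam : 0 < lam) (ht : 0 ≤ t) (hs : s ∈ Icc t T)
    {a : E} {g : ℝ → E} (ha : ‖a‖ ≤ m) (hg : ∀ σ ∈ Icc t T, ‖g σ‖ ≤ m) :
    ‖greenOp lam t T s a g‖ ≤ T * (1 + T) / lam * m := by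
  have htT : t ≤ T := hs.1.trans hs.2
  have hm : 0 ≤ m := (norm_nonneg a).trans ha
  have hT : 0 ≤ T := ht.trans htT
  have h1 : ‖∫ σ in t..T, (min s σ - t) • g σ‖ ≤ T * m * |T - t| := by
    apply intervalIntegral.norm_integral_le_of_norm_le_const
    intro σ hσ
    rw [uIoc_of_le htT] at hσ
    have h0 : 0 ≤ min s σ - t := sub_nonneg.2 (le_min hs.1 hσ.1.le)
    rw [norm_smul, Real.norm_of_nonneg h0]
    have h2 : min s σ - t ≤ T := by linarith [min_le_left s σ, hs.2]
    exact mul_le_mul h2 (hg σ ⟨hσ.1.le, hσ.2⟩) (norm_nonneg _) hT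
  rw [abs_of_nonneg (by linarith)] at h1
  have h3 : ‖∫ σ in t..T, (min s σ - t) • g σ‖ ≤ T * m * T :=
    h1.trans (mul_le_mul_of_nonneg_left (by linarith) (by positivity))
  have h4 : ‖((s - t) / lam) • a‖ ≤ T / lam * m := by
    rw [norm_smul, Real.norm_of_nonneg (div_nonneg (by linarith [hs.1]) hlam.le)]
    have : (s - t) / lam ≤ T / lam := by
      gcongr
      linarith [hs.2]
    exact mul_le_mul this ha (norm_nonneg _) (by positivity)
  have h5 : ‖(1 / lam) • ∫ σ in t..T, (min s σ - t) • g σ‖ ≤ 1 / lam * (T * m * T) := by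
    rw [norm_smul, Real.norm_of_nonneg (by positivity)]
    gcongr
  calc _ ≤ _ := norm_add_le _ _
    _ ≤ T / lam * m + 1 / lam * (T * m * T) := add_le_add h4 h5
    _ = _ := by ring

theorem greenOp_apply [CompleteSpace E] {lam t T s : ℝ} (htT : t ≤ T) (a : G →L[ℝ] E)
    {g : ℝ → G →L[ℝ] E} (hg : ContinuousOn g (Icc t T)) (h : G) :
    (greenOp lam t T s a g) h = greenOp lam t T s (a h) (fun σ => g σ h) := by
  simp only [greenOp, _root_.add_apply, _root_.smul_apply]
  rw [ContinuousLinearMap.intervalIntegral_apply (intervalIntegrable_min_sub_smul htT s hg)]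
  rfl

theorem greenOp_congr {lam t T s : ℝ} (htT : t ≤ T) (a : E) {g g' : ℝ → E}
    (hg : ∀ σ ∈ Icc t T, g σ = g' σ) :
    greenOp lam t T s a g = greenOp lam t T s a g' := by
  unfold greenOp
  congr 2
  apply intervalIntegral.integral_congr
  intro σ hσ
  rw [uIcc_of_le htT] at hσ
  simp only [hg σ hσ]

theorem greenOp_left {lam t T : ℝ} (htT : t ≤ T) (a : E) (g : ℝ → E) :
    greenOp lam t T t a g = 0 := by
  have : ∫ σ in t..T, (min t σ - t) • g σ = 0 := by
    rw [← intervalIntegral.integral_zero (a := t) (b := T) (μ := volume)]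
    apply intervalIntegral.integral_congr
    intro σ hσ
    rw [uIcc_of_le htT] at hσ
    simp [min_eq_left hσ.1]
  simp [greenOp, this]

theorem integral_min_sub_smul {t T s : ℝ} (hs : s ∈ Icc t T) {g : ℝ → E} (hg : Continuous g) :
    ∫ σ in t..T, (min s σ - t) • g σ
      = (∫ σ in t..s, (σ - t) • g σ) + (s - t) • ∫ σ in s..T, g σ := by
  have hi : ∀ a b, IntervalIntegrable (fun σ => (min s σ - t) • g σ) volume a b :=
    fun a b => Continuous.intervalIntegrable (by fun_prop) a b
  rw [← intervalIntegral.integral_add_adjacent_intervals (hi t s) (hi s T),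
    ← intervalIntegral.integral_smul]
  congr 1
  · apply intervalIntegral.integral_congr
    intro σ hσ
    rw [uIcc_of_le hs.1] at hσ
    simp only [min_eq_right hσ.2]
  · apply intervalIntegral.integral_congr
    intro σ hσ
    rw [uIcc_of_le hs.2] at hσ
    simp only [min_eq_left hσ.1]

theorem hasDerivWithinAt_greenOp_of_continuous [CompleteSpace E] {lam t T s : ℝ}
    (hs : s ∈ Icc t T) (a : E) {g : ℝ → E} (hg : Continuous g) :
    HasDerivWithinAt (fun s => greenOp lam t T s a g)
      ((1 / lam) • (a + ∫ σ in s..T, g σ)) (Icc t T) s := by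
  have h1 : HasDerivAt (fun s => ∫ σ in t..s, (σ - t) • g σ) ((s - t) • g s) s :=
    intervalIntegral.integral_hasDerivAt_right
      (Continuous.intervalIntegrable (by fun_prop) _ _)
      (Continuous.stronglyMeasurableAtFilter (by fun_prop) _ _)
      (Continuous.continuousAt (by fun_prop))
  have h2 : HasDerivAt (fun s => ∫ σ in s..T, g σ) (-g s) s :=
    intervalIntegral.integral_hasDerivAt_left (hg.intervalIntegrable _ _)
      (hg.stronglyMeasurableAtFilter _ _) hg.continuousAt
  have h3 : HasDerivAt (fun s : ℝ => s - t) 1 s := (hasDerivAt_id s).sub_const t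
  have h4 := ((h3.div_const lam).smul_const a).add ((h1.add (h3.smul h2)).const_smul (1 / lam))
  have h5 := h4.hasDerivWithinAt (s := Icc t T)
  refine (h5.congr_deriv ?_).congr (fun x hx => ?_) ?_
  · simp only [smul_add, smul_neg, one_smul]
    abel
  · simp only [greenOp, integral_min_sub_smul hx hg]
    rfl
  · simp only [greenOp, integral_min_sub_smul hs hg]
    rfl

theorem hasDerivWithinAt_greenOp [CompleteSpace E] {lam t T s : ℝ} (hs : s ∈ Icc t T) (a : E)
    {g : ℝ → E} (hg : ContinuousOn g (Icc t T)) :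
    HasDerivWithinAt (fun s => greenOp lam t T s a g)
      ((1 / lam) • (a + ∫ σ in s..T, g σ)) (Icc t T) s := by
  have htT : t ≤ T := hs.1.trans hs.2
  have hc : Continuous (IccExtend htT ((Icc t T).domRestrict g)) := hg.domRestrict.Icc_extend'
  have he : ∀ σ ∈ Icc t T, g σ = IccExtend htT ((Icc t T).domRestrict g) σ := fun σ hσ => by
    rw [IccExtend_of_mem htT _ hσ, domRestrict_apply]
  have hint : ∫ σ in s..T, g σ = ∫ σ in s..T, IccExtend htT ((Icc t T).domRestrict g) σ := by
    apply intervalIntegral.integral_congr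
    intro σ hσ
    rw [uIcc_of_le hs.2] at hσ
    exact he σ ⟨hs.1.trans hσ.1, hσ.2⟩
  simp only [hint, greenOp_congr htT a he]
  exact hasDerivWithinAt_greenOp_of_continuous hs a hc

theorem continuousOn_greenOp [CompleteSpace E] {lam t T : ℝ} (a : E) {g : ℝ → E}
    (hg : ContinuousOn g (Icc t T)) :
    ContinuousOn (fun s => greenOp lam t T s a g) (Icc t T) :=
  fun _ hs => (hasDerivWithinAt_greenOp hs a hg).continuousWithinAt

/-- Differentiability with a continuous derivative is uniform on compact sets. -/
theorem IsCompact.exists_norm_sub_sub_le {f : E → G} {f' : E → E →L[ℝ] G} {K : Set E}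
    (hK : IsCompact K) (hf : ∀ x, HasFDerivAt f (f' x) x) (hc : Continuous f') {η : ℝ}
    (hη : 0 < η) :
    ∃ r > 0, ∀ x ∈ K, ∀ y, ‖y - x‖ < r → ‖f y - f x - f' x (y - x)‖ ≤ η * ‖y - x‖ := by
  have h := hK.uniformContinuousAt_of_continuousAt f' (fun a _ => hc.continuousAt)
    (Metric.dist_mem_uniformity hη)
  obtain ⟨r, hr, hsub⟩ := Metric.mem_uniformity_dist.1 h
  refine ⟨r, hr, fun x hx y hy => ?_⟩
  refine (convex_ball x r).norm_image_sub_le_of_norm_hasFDerivWithin_le'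
    (fun z _ => (hf z).hasFDerivWithinAt) (fun z hz => ?_) (Metric.mem_ball_self hr)
    (mem_ball_iff_norm.2 hy)
  have h1 : dist x z < r := by rwa [dist_comm]
  have h2 : dist (f' x) (f' z) < η := hsub h1 hx
  rw [dist_comm, dist_eq_norm] at h2
  exact h2.le

theorem HasFDerivAt.norm_le_of_norm_sub_le {f : E → G} {f' : E →L[ℝ] G} {x : E} {c : ℝ}
    (hf : HasFDerivAt f f' x) (hc : 0 ≤ c) (h : ∀ y z, ‖f y - f z‖ ≤ c * ‖y - z‖) : ‖f'‖ ≤ c :=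
  hf.le_of_lip' hc (Filter.Eventually.of_forall fun y => h y x)

/-- Solvability of the linearized integral equation when `c T (1 + T) / λ < 1`. -/
theorem exists_eq_sub_greenOp [CompleteSpace E] {lam c t T : ℝ} (hlam : 0 < lam) (ht : 0 ≤ t)
    (htT : t ≤ T) (hk : T * (1 + T) / lam * c < 1) (e : G →L[ℝ] E) {A : E →L[ℝ] E}
    {B : ℝ → E →L[ℝ] E} (hA : ‖A‖ ≤ c) (hB : ∀ σ ∈ Icc t T, ‖B σ‖ ≤ c)
    (hBc : ContinuousOn B (Icc t T)) :
    ∃ D : ℝ → G →L[ℝ] E, ContinuousOn D (Icc t T) ∧ ∀ s ∈ Icc t T,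
      D s = e - greenOp lam t T s (A.comp (D T)) (fun σ => (B σ).comp (D σ)) := by
  have hT : 0 ≤ T := ht.trans htT
  have hc : 0 ≤ c := (norm_nonneg A).trans hA
  let ext : C(Icc t T, G →L[ℝ] E) → ℝ → G →L[ℝ] E := fun f => IccExtend htT f
  have hext : ∀ f, Continuous (ext f) := fun f => f.continuous.Icc_extend'
  have hg : ∀ f, ContinuousOn (fun σ => (B σ).comp (ext f σ)) (Icc t T) :=
    fun f => hBc.clm_comp (hext f).continuousOn
  let Φ : C(Icc t T, G →L[ℝ] E) → C(Icc t T, G →L[ℝ] E) := fun f =>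
    ⟨fun s => e - greenOp lam t T s (A.comp (ext f T)) (fun σ => (B σ).comp (ext f σ)),
      continuous_const.sub (continuousOn_greenOp _ (hg f)).domRestrict⟩
  have hq : 0 ≤ T * (1 + T) / lam * c := by positivity
  have hΦ : ContractingWith (T * (1 + T) / lam * c).toNNReal Φ := by
    refine ⟨Real.toNNReal_lt_one.2 hk, LipschitzWith.of_dist_le_mul fun f f' => ?_⟩
    suffices h : ‖Φ f - Φ f'‖ ≤ T * (1 + T) / lam * c * ‖f - f'‖ by
      rw [Real.coe_toNNReal _ hq]
      exact ((dist_eq_norm (Φ f) (Φ f')).trans_le h).trans_eq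
        (congrArg _ (dist_eq_norm f f').symm)
    refine (ContinuousMap.norm_le _ (by positivity)).2 fun s => ?_
    have hd : ∀ σ, ‖ext f σ - ext f' σ‖ ≤ ‖f - f'‖ := fun σ =>
      (f - f').norm_coe_le_norm (projIcc t T htT σ)
    have h1 : (Φ f - Φ f') s = -greenOp lam t T s (A.comp (ext f T) - A.comp (ext f' T))
        (fun σ => (B σ).comp (ext f σ) - (B σ).comp (ext f' σ)) := by
      rw [greenOp_sub htT _ _ (hg f) (hg f')]
      simp only [Φ, ContinuousMap.sub_apply, ContinuousMap.coe_mk]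
      abel
    rw [h1, norm_neg]
    refine (norm_greenOp_le (m := c * ‖f - f'‖) hlam ht s.2 ?_ fun σ hσ => ?_).trans
      (mul_assoc _ _ _).ge
    · rw [← ContinuousLinearMap.comp_sub]
      exact (ContinuousLinearMap.opNorm_comp_le _ _).trans
        (mul_le_mul hA (hd T) (norm_nonneg _) hc)
    · rw [← ContinuousLinearMap.comp_sub]
      exact (ContinuousLinearMap.opNorm_comp_le _ _).trans
        (mul_le_mul (hB σ hσ) (hd σ) (norm_nonneg _) hc)
  have hfix : Φ (hΦ.fixedPoint Φ) = hΦ.fixedPoint Φ := hΦ.fixedPoint_isFixedPt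
  refine ⟨ext (hΦ.fixedPoint Φ), (hext _).continuousOn, fun s hs => ?_⟩
  have h2 : ext (hΦ.fixedPoint Φ) s = hΦ.fixedPoint Φ ⟨s, hs⟩ := IccExtend_of_mem htT _ hs
  rw [h2]
  exact (DFunLike.congr_fun hfix ⟨s, hs⟩).symm

end Kernel

/-- The integral form of the two-point boundary value problem. -/
theorem IsOptimalPath.eq_sub_greenOp {DF DFT : H → H} {lam t T : ℝ} {X : H} {Y : ℝ → H}
    (hY : IsOptimalPath DF DFT lam T X t Y) (hDF : Continuous DF) :
    ∀ s ∈ Icc t T, Y s = X - greenOp lam t T s (DFT (Y T)) (fun σ => DF (Y σ)) := by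
  intro s hs
  have htT : t ≤ T := hs.1.trans hs.2
  have hg : ContinuousOn (fun σ => DF (Y σ)) (Icc t T) := hDF.comp_continuousOn hY.1
  have hd : ∀ x ∈ Icc t T, HasDerivWithinAt
      (fun s => Y s + greenOp lam t T s (DFT (Y T)) (fun σ => DF (Y σ))) 0 (Icc t T) x := by
    intro x hx
    refine ((hY.2.2 x hx).add (hasDerivWithinAt_greenOp hx (DFT (Y T)) hg)).congr_deriv ?_
    rw [adjZ, neg_smul, neg_add_cancel]
  have h := constant_of_has_deriv_right_zero (fun x hx => (hd x hx).continuousWithinAt)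
    (fun x hx => (hd x ⟨hx.1, hx.2.le⟩).mono_of_mem_nhdsWithin (Icc_mem_nhdsGE_of_mem hx)) s hs
  rw [greenOp_left htT, hY.2.1, add_zero] at h
  exact eq_sub_of_add_eq h

/-- Lipschitz dependence of the optimal trajectory on the initial state. -/
theorem IsOptimalPath.norm_path_sub_le {DF DFT : H → H} {lam c t T : ℝ} (hlam : 0 < lam) (ht : 0 ≤ t)
    (htT : t ≤ T) (hc : 0 ≤ c) (hk : T * (1 + T) / lam * c < 1) (hDFc : Continuous DF)
    (hDF : ∀ X₁ X₂ : H, ‖DF X₁ - DF X₂‖ ≤ c * ‖X₁ - X₂‖)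
    (hDFT : ∀ X₁ X₂ : H, ‖DFT X₁ - DFT X₂‖ ≤ c * ‖X₁ - X₂‖) {X X' : H} {Y Y' : ℝ → H}
    (hY : IsOptimalPath DF DFT lam T X t Y) (hY' : IsOptimalPath DF DFT lam T X' t Y') :
    ∀ s ∈ Icc t T, ‖Y' s - Y s‖ ≤ ‖X' - X‖ / (1 - T * (1 + T) / lam * c) := by
  refine norm_le_div_one_sub_of_self_bound hk (hY'.1.sub hY.1) fun m hm s hs => ?_
  have h : Y' s - Y s = (X' - X) - greenOp lam t T s (DFT (Y' T) - DFT (Y T))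
      (fun σ => DF (Y' σ) - DF (Y σ)) := by
    rw [greenOp_sub (g := fun σ => DF (Y' σ)) (g' := fun σ => DF (Y σ)) htT _ _
      (hDFc.comp_continuousOn hY'.1) (hDFc.comp_continuousOn hY.1)]
    nth_rewrite 1 [hY'.eq_sub_greenOp hDFc s hs, hY.eq_sub_greenOp hDFc s hs]
    abel
  have hG : ‖greenOp lam t T s (DFT (Y' T) - DFT (Y T)) (fun σ => DF (Y' σ) - DF (Y σ))‖
      ≤ T * (1 + T) / lam * (c * m) :=
    norm_greenOp_le hlam ht hs
      ((hDFT _ _).trans (mul_le_mul_of_nonneg_left (hm T ⟨htT, le_rfl⟩) hc))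
      fun σ hσ => (hDF _ _).trans (mul_le_mul_of_nonneg_left (hm σ hσ) hc)
  have := norm_sub_le (X' - X) (greenOp lam t T s (DFT (Y' T) - DFT (Y T))
      (fun σ => DF (Y' σ) - DF (Y σ)))
  rw [← h] at this
  linarith

/-- A solution of the linearized equation is the derivative of the optimal trajectory. -/
theorem hasFDerivAt_optimalPath {DF DFT : H → H} {lam c t T : ℝ} (hlam : 0 < lam) (ht : 0 ≤ t)
    (htT : t ≤ T) (hc : 0 ≤ c) (hk : T * (1 + T) / lam * c < 1)
    (hDF : ∀ X₁ X₂ : H, ‖DF X₁ - DF X₂‖ ≤ c * ‖X₁ - X₂‖)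
    (hDFT : ∀ X₁ X₂ : H, ‖DFT X₁ - DFT X₂‖ ≤ c * ‖X₁ - X₂‖)
    {D2F D2FT : H → H →L[ℝ] H}
    (hD2F : ∀ X : H, HasFDerivAt DF (D2F X) X) (hD2Fc : Continuous D2F)
    (hD2FT : ∀ X : H, HasFDerivAt DFT (D2FT X) X) (hD2FTc : Continuous D2FT)
    {X : H} {YF : H → ℝ → H} (hYF : ∀ X' : H, IsOptimalPath DF DFT lam T X' t (YF X'))
    {D : ℝ → H →L[ℝ] H} (hDc : ContinuousOn D (Icc t T))
    (hD : ∀ s ∈ Icc t T, D s = ContinuousLinearMap.id ℝ H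
      - greenOp lam t T s ((D2FT (YF X T)).comp (D T)) (fun σ => (D2F (YF X σ)).comp (D σ))) :
    ∀ s ∈ Icc t T, HasFDerivAt (fun X' => YF X' s) (D s) X := by
  have hT : 0 ≤ T := ht.trans htT
  have hTm : T ∈ Icc t T := ⟨htT, le_rfl⟩
  have hDFc : Continuous DF := continuous_iff_continuousAt.2 fun x => (hD2F x).continuousAt
  obtain ⟨q, hq⟩ : ∃ q, q = T * (1 + T) / lam := ⟨_, rfl⟩
  have hq0 : 0 ≤ q := by rw [hq]; positivity
  have hLip := fun X' => (hYF X).norm_path_sub_le hlam ht htT hc hk hDFc hDF hDFT (hYF X')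
  rw [← hq] at hk hLip
  have hk' : 0 < 1 - q * c := by linarith
  intro s₀ hs₀
  refine HasFDerivAt.of_isLittleO (Asymptotics.isLittleO_iff.2 fun ε hε => ?_)
  have hη : 0 < ε * (1 - q * c) ^ 2 / (q + 1) := by positivity
  obtain ⟨η, hηdef⟩ : ∃ η, η = ε * (1 - q * c) ^ 2 / (q + 1) := ⟨_, rfl⟩
  rw [← hηdef] at hη
  have hK : IsCompact (YF X '' Icc t T) := isCompact_Icc.image_of_continuousOn (hYF X).1
  obtain ⟨r₁, hr₁, h₁⟩ := hK.exists_norm_sub_sub_le hD2F hD2Fc hη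
  obtain ⟨r₂, hr₂, h₂⟩ := hK.exists_norm_sub_sub_le hD2FT hD2FTc hη
  have hball : Metric.ball X ((1 - q * c) * min r₁ r₂) ∈ nhds X :=
    Metric.ball_mem_nhds _ (mul_pos hk' (lt_min hr₁ hr₂))
  filter_upwards [hball] with X' hX'
  rw [mem_ball_iff_norm] at hX'
  obtain ⟨L, hL⟩ : ∃ L, L = ‖X' - X‖ / (1 - q * c) := ⟨_, rfl⟩
  have hLr : L < min r₁ r₂ := by rw [hL, div_lt_iff₀ hk', mul_comm]; exact hX'
  have hYL : ∀ σ ∈ Icc t T, ‖YF X' σ - YF X σ‖ ≤ L := fun σ hσ => hL ▸ hLip X' σ hσ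
  have hDch : ContinuousOn (fun σ => D σ (X' - X)) (Icc t T) := hDc.clm_apply continuousOn_const
  have hcomp : ContinuousOn (fun σ => (D2F (YF X σ)).comp (D σ)) (Icc t T) :=
    (hD2Fc.comp_continuousOn (hYF X).1).clm_comp hDc
  have hcomph : ContinuousOn (fun σ => ((D2F (YF X σ)).comp (D σ)) (X' - X)) (Icc t T) :=
    hcomp.clm_apply continuousOn_const
  have hgX : ContinuousOn (fun σ => DF (YF X σ)) (Icc t T) :=
    hDFc.comp_continuousOn (hYF X).1
  have hgX' : ContinuousOn (fun σ => DF (YF X' σ)) (Icc t T) :=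
    hDFc.comp_continuousOn (hYF X').1
  have hrem : ∀ {f : H → H} {A : H →L[ℝ] H} {σ m : ℝ}, σ ∈ Icc t T → ‖A‖ ≤ c →
      ‖f (YF X' σ) - f (YF X σ) - A (YF X' σ - YF X σ)‖ ≤ η * ‖YF X' σ - YF X σ‖ →
      ‖YF X' σ - YF X σ - D σ (X' - X)‖ ≤ m →
      ‖f (YF X' σ) - f (YF X σ) - (A.comp (D σ)) (X' - X)‖ ≤ c * m + η * L := by
    intro f A σ m hσ hA hf hm
    have heq : f (YF X' σ) - f (YF X σ) - (A.comp (D σ)) (X' - X)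
        = A (YF X' σ - YF X σ - D σ (X' - X))
          + (f (YF X' σ) - f (YF X σ) - A (YF X' σ - YF X σ)) := by
      rw [map_sub A (YF X' σ - YF X σ), ContinuousLinearMap.comp_apply]
      abel
    rw [heq]
    refine (norm_add_le _ _).trans (add_le_add ?_ ?_)
    · exact (A.le_opNorm _).trans (mul_le_mul hA hm (norm_nonneg _) hc)
    · exact hf.trans (mul_le_mul_of_nonneg_left (hYL σ hσ) hη.le)
  have hmain : ∀ s ∈ Icc t T, ‖YF X' s - YF X s - D s (X' - X)‖ ≤ q * (η * L) / (1 - q * c) := by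
    refine norm_le_div_one_sub_of_self_bound hk (((hYF X').1.sub (hYF X).1).sub hDch)
      fun m hm s hs => ?_
    have heq : YF X' s - YF X s - D s (X' - X)
        = -greenOp lam t T s
            (DFT (YF X' T) - DFT (YF X T) - ((D2FT (YF X T)).comp (D T)) (X' - X))
            (fun σ => DF (YF X' σ) - DF (YF X σ) - ((D2F (YF X σ)).comp (D σ)) (X' - X)) := by
      rw [greenOp_sub (g := fun σ => DF (YF X' σ) - DF (YF X σ)) htT _ _
          (hgX'.sub hgX) hcomph, greenOp_sub htT _ _ hgX' hgX,
        ← greenOp_apply htT _ hcomp]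
      nth_rewrite 1 [(hYF X').eq_sub_greenOp hDFc s hs, (hYF X).eq_sub_greenOp hDFc s hs, hD s hs]
      rw [_root_.sub_apply, ContinuousLinearMap.id_apply]
      abel
    rw [heq, norm_neg]
    have hG := norm_greenOp_le hlam ht hs (m := c * m + η * L)
      (hrem hTm ((hD2FT _).norm_le_of_norm_sub_le hc hDFT)
        (h₂ _ (mem_image_of_mem _ hTm) _
          ((hYL T hTm).trans_lt (hLr.trans_le (min_le_right _ _)))) (hm T hTm))
      fun σ hσ => hrem hσ ((hD2F _).norm_le_of_norm_sub_le hc hDF)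
        (h₁ _ (mem_image_of_mem _ hσ) _
          ((hYL σ hσ).trans_lt (hLr.trans_le (min_le_left _ _)))) (hm σ hσ)
    rw [← hq] at hG
    exact hG.trans (le_of_eq (by ring))
  refine (hmain s₀ hs₀).trans ?_
  have hfin : q * (η * L) / (1 - q * c) = q / (q + 1) * (ε * ‖X' - X‖) := by
    rw [hL, hηdef]
    field_simp
  rw [hfin]
  exact mul_le_of_le_one_left (by positivity) (by rw [div_le_one (by positivity)]; linarith)

/-- differentiability of the optimal trajectory with respect to the initial
state: `D_X Y(s)` is the unique solution of the linearized integral equation, and satisfies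
the operator-norm bound `λ/(λ - cT(T+1))`. -/
theorem statement15
    (F FT : H → ℝ) (DF DFT : H → H) (c T lam : ℝ)
    (hF : ∀ X, HasGradientAt F (DF X) X) (hFT : ∀ X, HasGradientAt FT (DFT X) X)
    (hDF : ∀ X₁ X₂ : H, ‖DF X₁ - DF X₂‖ ≤ c * ‖X₁ - X₂‖)
    (hDFT : ∀ X₁ X₂ : H, ‖DFT X₁ - DFT X₂‖ ≤ c * ‖X₁ - X₂‖)
    (hDF0 : ‖DF 0‖ ≤ c) (hDFT0 : ‖DFT 0‖ ≤ c)
    (hT : 0 < T) (hlam : 0 < lam)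
    (D2F D2FT : H → H →L[ℝ] H)
    (hD2F : ∀ X : H, HasFDerivAt DF (D2F X) X) (hD2Fc : Continuous D2F)
    (hD2FT : ∀ X : H, HasFDerivAt DFT (D2FT X) X) (hD2FTc : Continuous D2FT)
    (hlc : c * T * (1 + T) < lam)
    (t : ℝ) (ht : t ∈ Icc 0 T) (X : H)
    (YF : H → ℝ → H)
    (hYF : ∀ X' : H, IsOptimalPath DF DFT lam T X' t (YF X')) :
    ∃ DY : ℝ → H →L[ℝ] H, ContinuousOn DY (Icc t T) ∧
      (∀ s ∈ Icc t T, DY s = ContinuousLinearMap.id ℝ H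
        - ((s - t) / lam) • (D2FT (YF X T)).comp (DY T)
        - (1 / lam) • ∫ σ in t..T, (min s σ - t) • (D2F (YF X σ)).comp (DY σ)) ∧
      (∀ DY' : ℝ → H →L[ℝ] H, ContinuousOn DY' (Icc t T) →
        (∀ s ∈ Icc t T, DY' s = ContinuousLinearMap.id ℝ H
          - ((s - t) / lam) • (D2FT (YF X T)).comp (DY' T)
          - (1 / lam) • ∫ σ in t..T, (min s σ - t) • (D2F (YF X σ)).comp (DY' σ)) →
        ∀ s ∈ Icc t T, DY' s = DY s) ∧
      (∀ s ∈ Icc t T, HasFDerivAt (fun X' => YF X' s) (DY s) X) ∧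
      (∀ s ∈ Icc t T, ‖DY s‖ ≤ lam / (lam - c * T * (T + 1))) := by
  have hc : 0 ≤ c := (norm_nonneg _).trans hDF0
  obtain ⟨ht0, htT⟩ := ht
  have hTm : T ∈ Icc t T := ⟨htT, le_rfl⟩
  have hk : T * (1 + T) / lam * c < 1 := by
    rw [div_mul_eq_mul_div, div_lt_one hlam]
    linarith
  have hA : ‖D2FT (YF X T)‖ ≤ c := (hD2FT _).norm_le_of_norm_sub_le hc hDFT
  have hB : ∀ σ, ‖D2F (YF X σ)‖ ≤ c := fun σ => (hD2F _).norm_le_of_norm_sub_le hc hDF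
  have hBc : ContinuousOn (fun σ => D2F (YF X σ)) (Icc t T) :=
    hD2Fc.comp_continuousOn (hYF X).1
  obtain ⟨D, hDc, hD⟩ := exists_eq_sub_greenOp hlam ht0 htT hk (ContinuousLinearMap.id ℝ H) hA
    (fun σ _ => hB σ) hBc
  have hcomp : ∀ {A B : H →L[ℝ] H} {m : ℝ}, ‖A‖ ≤ c → ‖B‖ ≤ m → ‖A.comp B‖ ≤ c * m :=
    fun hA hB => (ContinuousLinearMap.opNorm_comp_le _ _).trans
      (mul_le_mul hA hB (norm_nonneg _) hc)
  refine ⟨D, hDc, fun s hs => (hD s hs).trans (sub_sub _ _ _).symm, fun D' hD'c hD' s hs => ?_,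
    hasFDerivAt_optimalPath hlam ht0 htT hc hk hDF hDFT hD2F hD2Fc hD2FT hD2FTc hYF hDc hD,
    fun s hs => ?_⟩
  · have hz := norm_le_div_one_sub_of_self_bound (b := 0) (u := fun s => D' s - D s) hk (hD'c.sub hDc)
      (fun m hm s hs => ?_) s hs
    · rw [zero_div, norm_le_zero_iff] at hz
      exact sub_eq_zero.1 hz
    · have heq : D' s - D s = -greenOp lam t T s
          ((D2FT (YF X T)).comp (D' T) - (D2FT (YF X T)).comp (D T))
          (fun σ => (D2F (YF X σ)).comp (D' σ) - (D2F (YF X σ)).comp (D σ)) := by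
        rw [greenOp_sub htT _ _ (hBc.clm_comp hD'c) (hBc.clm_comp hDc)]
        nth_rewrite 1 [(hD' s hs).trans (sub_sub _ _ _), hD s hs]
        rw [sub_sub_sub_cancel_left, neg_sub]
        rfl
      rw [heq, norm_neg, add_zero, mul_assoc]
      refine norm_greenOp_le hlam ht0 hs ?_ fun σ hσ => ?_
      · rw [← ContinuousLinearMap.comp_sub]
        exact hcomp hA (hm T hTm)
      · rw [← ContinuousLinearMap.comp_sub]
        exact hcomp (hB σ) (hm σ hσ)
  · have hb := norm_le_div_one_sub_of_self_bound (b := 1) hk hDc (fun m hm s hs => ?_) s hs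
    · refine hb.trans (le_of_eq ?_)
      have h1 : lam - c * T * (T + 1) ≠ 0 := by linarith
      have h2 : 1 - T * (1 + T) / lam * c = (lam - c * T * (T + 1)) / lam := by
        field_simp
        ring
      rw [h2, one_div_div]
    · rw [hD s hs]
      refine (norm_sub_le _ _).trans ?_
      have hG := norm_greenOp_le hlam ht0 hs (hcomp hA (hm T hTm))
        fun σ hσ => hcomp (hB σ) (hm σ hσ)
      linarith [ContinuousLinearMap.norm_id_le (𝕜 := ℝ) (E := H)]
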